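/- arXiv:2507.08755 — 7 statements merged into one kernel-verified Lean document; each statement's English description precedes it below -/
import Mathlib

section
/- Assume 1 ≤ k ≤ n−1. The code C_1(b,c) is MDS (equivalently, every k columns of G_1(b,c) are linearly independent) if and only if for all indices 1 ≤ i_1 < i_2 < ⋯ < i_{k−1} ≤ n−1 one has ∏_{j=1}^{k−1}(b − a_{i_j}) − λ ∏_{j=1}^{k−1}(c − a_{i_j}) ≠ 0. -/
open Matrix Finset

/-- The `k × (m+1)` one-column-twisted generator matrix `G_1(b,c)`:
columns `0,…,m-1` are `(a_j^s)_s`, last column is `(b^s - λ c^s)_s`. -/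
def G1mat {F : Type*} [Field F] (k m : ℕ) (a : Fin m → F) (b c lam : F) :
    Matrix (Fin k) (Fin (m + 1)) F :=
  Matrix.of fun s j =>
    if h : (j : ℕ) < m then a ⟨j, h⟩ ^ (s : ℕ)
    else b ^ (s : ℕ) - lam * c ^ (s : ℕ)

/-- The extended matrix `G_1(b,c,∞)`, with the extra column `(0,…,0,1)ᵀ`. -/
def G1matInf {F : Type*} [Field F] (k m : ℕ) (a : Fin m → F) (b c lam : F) :
    Matrix (Fin k) (Fin (m + 2)) F :=
  Matrix.of fun s j =>
    if h : (j : ℕ) < m then a ⟨j, h⟩ ^ (s : ℕ)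
    else if (j : ℕ) = m then b ^ (s : ℕ) - lam * c ^ (s : ℕ)
    else if (s : ℕ) = k - 1 then 1 else 0

/-- The `k × (m+2)` two-column-twisted generator matrix `G_2(b,c)`. -/
def G2mat {F : Type*} [Field F] (k m : ℕ) (a : Fin m → F) (b c l1 l2 : F) :
    Matrix (Fin k) (Fin (m + 2)) F :=
  Matrix.of fun s j =>
    if h : (j : ℕ) < m then a ⟨j, h⟩ ^ (s : ℕ)
    else if (j : ℕ) = m then b ^ (s : ℕ) - l1 * c ^ (s : ℕ)
    else b ^ (s : ℕ) - l2 * c ^ (s : ℕ)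

/-- The extended matrix `G_2(b,c,∞)`, with the extra column `(0,…,0,1)ᵀ`. -/
def G2matInf {F : Type*} [Field F] (k m : ℕ) (a : Fin m → F) (b c l1 l2 : F) :
    Matrix (Fin k) (Fin (m + 3)) F :=
  Matrix.of fun s j =>
    if h : (j : ℕ) < m then a ⟨j, h⟩ ^ (s : ℕ)
    else if (j : ℕ) = m then b ^ (s : ℕ) - l1 * c ^ (s : ℕ)
    else if (j : ℕ) = m + 1 then b ^ (s : ℕ) - l2 * c ^ (s : ℕ)
    else if (s : ℕ) = k - 1 then 1 else 0

/-- The code generated by a matrix: the span of its rows. -/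
def rowSpan {F : Type*} [Field F] {k N : ℕ} (G : Matrix (Fin k) (Fin N) F) :
    Submodule F (Fin N → F) :=
  Submodule.span F (Set.range fun s => G s)

/-- Every `k` columns of the `k × N` matrix `G` are linearly independent. -/
def colsIndep {F : Type*} [Field F] {k N : ℕ} (G : Matrix (Fin k) (Fin N) F) : Prop :=
  ∀ e : Fin k → Fin N, Function.Injective e → (G.submatrix id e).det ≠ 0

/-- Minimum Hamming distance (= minimum Hamming weight) of a linear code. -/
noncomputable def minDist {F : Type*} [Field F] [DecidableEq F] {N : ℕ}
    (C : Submodule F (Fin N → F)) : ℕ :=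
  sInf {d | ∃ x ∈ C, x ≠ 0 ∧ hammingNorm x = d}

/-- The Schur (componentwise) product of two linear codes. -/
def schurMul {F : Type*} [Field F] {N : ℕ} (C D : Submodule F (Fin N → F)) :
    Submodule F (Fin N → F) :=
  Submodule.span F {x | ∃ c ∈ C, ∃ d ∈ D, x = c * d}

/-- The Reed–Solomon code `RS_{k,N}(a)`. -/
def RSCode {F : Type*} [Field F] (k N : ℕ) (a : Fin N → F) : Submodule F (Fin N → F) :=
  Submodule.span F
    {x | ∃ f : Polynomial F, f.degree < (k : WithBot ℕ) ∧ x = fun j => f.eval (a j)}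

/-- The extended Reed–Solomon code `RS_{k,n-1}(a,∞)` of total length `n`. -/
def RSextCode {F : Type*} [Field F] (k n : ℕ) (a : Fin (n - 1) → F) :
    Submodule F (Fin n → F) :=
  Submodule.span F
    {x | ∃ f : Polynomial F, f.degree < (k : WithBot ℕ) ∧
      x = fun j : Fin n =>
        if h : (j : ℕ) < n - 1 then f.eval (a ⟨j, h⟩) else f.coeff (k - 1)}

/-- Equivalence of linear codes: equal up to a permutation of coordinates and
multiplication by nonzero scalars in each coordinate. -/
def codeEquiv {F : Type*} [Field F] {N : ℕ} (C D : Submodule F (Fin N → F)) : Prop :=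
  ∃ π : Equiv.Perm (Fin N), ∃ v : Fin N → F, (∀ i, v i ≠ 0) ∧
    (C : Set (Fin N → F)) =
      (fun x : Fin N → F => fun i => v i * x (π i)) '' (D : Set (Fin N → F))

/-- The dual code with respect to the standard bilinear form. -/
def dualCode {F : Type*} [Field F] {N : ℕ} (C : Submodule F (Fin N → F)) :
    Submodule F (Fin N → F) where
  carrier := {y | ∀ x ∈ C, ∑ i, x i * y i = 0}
  add_mem' := by
    intro y z hy hz x hx
    have hy' := hy x hx
    have hz' := hz x hx
    simp only [Set.mem_setOf_eq, Pi.add_apply, mul_add, Finset.sum_add_distrib, hy', hz',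
      add_zero]
  zero_mem' := by intro x hx; simp
  smul_mem' := by
    intro c y hy x hx
    have h := hy x hx
    simp only [Set.mem_setOf_eq, Pi.smul_apply, smul_eq_mul, mul_left_comm, ← Finset.mul_sum,
      h, mul_zero]

lemma Matrix.det_vandermonde_cons {R : Type*} [CommRing R] {r : ℕ} (x : R) (v : Fin r → R) :
    (vandermonde (Fin.cons x v : Fin (r + 1) → R)).det =
      (∏ j, (v j - x)) * (vandermonde v).det := by
  rw [det_vandermonde, Fin.prod_univ_succ, Fin.prod_Ioi_zero, det_vandermonde]
  simp [Fin.prod_Ioi_succ]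

lemma prod_sub_eq_neg_one_pow_mul {R : Type*} [CommRing R] {r : ℕ} (x : R) (v : Fin r → R) :
    ∏ j, (v j - x) = (-1) ^ r * ∏ j, (x - v j) := by
  rw [← Fin.prod_const, ← Finset.prod_mul_distrib]
  exact Finset.prod_congr rfl fun j _ => by ring

lemma G1mat_castSucc {F : Type*} [Field F] {k m : ℕ} (a : Fin m → F) (b c lam : F)
    (s : Fin k) (j : Fin m) : G1mat k m a b c lam s j.castSucc = a j ^ (s : ℕ) := by
  simp [G1mat]

lemma G1mat_last {F : Type*} [Field F] {k m : ℕ} (a : Fin m → F) (b c lam : F)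
    (s : Fin k) : G1mat k m a b c lam s (Fin.last m) = b ^ (s : ℕ) - lam * c ^ (s : ℕ) := by
  simp [G1mat]

/-- The maximal minor of `G1mat` on the twisted column followed by the columns `e`. -/
lemma G1mat_det_cons_last {F : Type*} [Field F] {r m : ℕ} (a : Fin m → F) (b c lam : F)
    (e : Fin r → Fin m) :
    ((G1mat (r + 1) m a b c lam).submatrix id
      (Fin.cons (Fin.last m) (Fin.castSucc ∘ e) : Fin (r + 1) → Fin (m + 1))).det =
    (-1) ^ r * ((∏ j, (b - a (e j))) - lam * ∏ j, (c - a (e j))) *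
      (vandermonde (a ∘ e)).det := by
  set V := vandermonde (Fin.cons b (a ∘ e) : Fin (r + 1) → F) with hV
  have hrow (x : F) : V.updateRow 0 (fun s => x ^ (s : ℕ)) =
      vandermonde (Fin.cons x (a ∘ e) : Fin (r + 1) → F) := by
    ext i s
    refine Fin.cases ?_ (fun i => ?_) i
    · rw [updateRow_self, vandermonde_apply, Fin.cons_zero]
    · rw [updateRow_ne (Fin.succ_ne_zero i), hV, vandermonde_apply, vandermonde_apply,
        Fin.cons_succ, Fin.cons_succ]
  have hmat : ((G1mat (r + 1) m a b c lam).submatrix id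
      (Fin.cons (Fin.last m) (Fin.castSucc ∘ e) : Fin (r + 1) → Fin (m + 1)))ᵀ =
      V.updateRow 0 ((fun s : Fin (r + 1) => b ^ (s : ℕ)) +
        (-lam) • fun s : Fin (r + 1) => c ^ (s : ℕ)) := by
    ext i s
    refine Fin.cases ?_ (fun i => ?_) i
    · simp [G1mat_last, sub_eq_add_neg]
    · rw [updateRow_ne (Fin.succ_ne_zero i), hV, vandermonde_apply, Fin.cons_succ]
      simp [G1mat_castSucc]
  rw [← det_transpose, hmat, det_updateRow_add, det_updateRow_smul, hrow, hrow,
    det_vandermonde_cons, det_vandermonde_cons, prod_sub_eq_neg_one_pow_mul,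
    prod_sub_eq_neg_one_pow_mul]
  simp only [Function.comp_apply]
  ring

/-- For `1 ≤ k ≤ n-1` (here `n = m+1`), the code `C_1(b,c)` is MDS,
i.e. every `k` columns of `G_1(b,c)` are linearly independent, iff for all
`1 ≤ i_1 < ⋯ < i_{k-1} ≤ n-1` one has
`∏ (b - a_{i_j}) - λ ∏ (c - a_{i_j}) ≠ 0`. -/
theorem C1_MDS_iff {F : Type*} [Field F] [Fintype F] (m k : ℕ)
    (hk1 : 1 ≤ k) (hkm : k ≤ m)
    (a : Fin m → F) (b c lam : F)
    (hainj : Function.Injective a) (hab : ∀ i, a i ≠ b) (hac : ∀ i, a i ≠ c)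
    (hbc : b ≠ c) :
    colsIndep (G1mat k m a b c lam) ↔
      ∀ e : Fin (k - 1) → Fin m, StrictMono e →
        (∏ j, (b - a (e j))) - lam * ∏ j, (c - a (e j)) ≠ 0 := by
  obtain ⟨r, rfl⟩ : ∃ r, k = r + 1 := ⟨k - 1, by omega⟩
  change _ ↔ ∀ e : Fin r → Fin m, StrictMono e →
        (∏ j, (b - a (e j))) - lam * ∏ j, (c - a (e j)) ≠ 0
  constructor
  · intro h e he h0
    refine h (Fin.cons (Fin.last m) (Fin.castSucc ∘ e)) ?_ ?_
    · refine Fin.cons_injective_iff.2 ⟨?_, (Fin.castSucc_injective m).comp he.injective⟩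
      rintro ⟨j, hj⟩
      exact Fin.castSucc_ne_last _ hj
    · rw [G1mat_det_cons_last, h0]
      simp
  · intro h e he
    by_cases hlast : ∃ i, e i = Fin.last m
    · obtain ⟨i, hi⟩ := hlast
      have hne (j : Fin r) : e (Equiv.swap 0 i j.succ) ≠ Fin.last m := fun hj => by
        have := he (hj.trans hi.symm)
        rw [Equiv.swap_apply_eq_iff, Equiv.swap_apply_right] at this
        exact Fin.succ_ne_zero _ this
      set e₁ : Fin r → Fin m := fun j => (e (Equiv.swap 0 i j.succ)).castPred (hne j) with he₁
      have hcons : e ∘ Equiv.swap 0 i = Fin.cons (Fin.last m) (Fin.castSucc ∘ e₁) := by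
        funext j
        refine Fin.cases ?_ (fun j => ?_) j <;> simp [he₁, hi]
      have hinj : Function.Injective e₁ := fun j j' hj => by
        have := he (Fin.castPred_inj.1 hj)
        simpa using this
      set σ := Tuple.sort e₁
      have hprod := h (e₁ ∘ σ)
        ((Tuple.monotone_sort e₁).strictMono_of_injective (hinj.comp σ.injective))
      simp only [Function.comp_apply] at hprod
      rw [Equiv.prod_comp σ (fun j => b - a (e₁ j)),
        Equiv.prod_comp σ (fun j => c - a (e₁ j))] at hprod
      have hdet := det_permute' (Equiv.swap 0 i) ((G1mat (r + 1) m a b c lam).submatrix id e)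
      rw [submatrix_submatrix, hcons, Function.comp_id, G1mat_det_cons_last] at hdet
      refine right_ne_zero_of_mul (hdet ▸ mul_ne_zero (mul_ne_zero (by simp) hprod) ?_)
      exact det_vandermonde_ne_zero_iff.2 (hainj.comp hinj)
    · push Not at hlast
      have hmat : ((G1mat (r + 1) m a b c lam).submatrix id e)ᵀ =
          vandermonde fun i => a ((e i).castPred (hlast i)) := by
        ext i s
        rw [vandermonde_apply, ← G1mat_castSucc a b c lam]
        simp
      rw [← det_transpose, hmat]
      exact det_vandermonde_ne_zero_iff.2 fun i j hij => he (Fin.castPred_inj.1 (hainj hij))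
end

section
/- Assume 2 ≤ k ≤ n−1. The code C_1(b,c,∞) is MDS (equivalently, every k columns of G_1(b,c,∞) are linearly independent) if and only if for every s ∈ {k−2, k−1} and all indices 1 ≤ i_1 < i_2 < ⋯ < i_s ≤ n−1 one has ∏_{j=1}^{s}(b − a_{i_j}) − λ ∏_{j=1}^{s}(c − a_{i_j}) ≠ 0. -/
open Matrix Finset

open Polynomial in
/-- The functional on polynomials of degree less than `k` given by column `j` of
`G1matInf k m a b c lam`. -/
noncomputable def columnEval {F : Type*} [Field F] (k m : ℕ) (a : Fin m → F) (b c lam : F)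
    (f : F[X]) (j : Fin (m + 2)) : F :=
  ∑ s : Fin k, f.coeff s * G1matInf k m a b c lam s j

section

open Polynomial

variable {F : Type*} [Field F] {k m : ℕ} {a : Fin m → F} {b c lam : F}

theorem columnEval_castSucc_castSucc {f : F[X]} (hf : f.degree < k) (i : Fin m) :
    columnEval k m a b c lam f i.castSucc.castSucc = f.eval (a i) := by
  rw [columnEval, eval_eq_sum_degreeLTEquiv (mem_degreeLT.2 hf)]
  simp [G1matInf, degreeLTEquiv]

theorem columnEval_castSucc_last {f : F[X]} (hf : f.degree < k) :
    columnEval k m a b c lam f (Fin.last m).castSucc = f.eval b - lam * f.eval c := by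
  rw [columnEval, eval_eq_sum_degreeLTEquiv (mem_degreeLT.2 hf),
    eval_eq_sum_degreeLTEquiv (mem_degreeLT.2 hf), Finset.mul_sum, ← Finset.sum_sub_distrib]
  refine Finset.sum_congr rfl fun s _ => ?_
  simp only [G1matInf, degreeLTEquiv, of_apply, Fin.val_castSucc, Fin.val_last, lt_irrefl,
    dite_false, if_true, LinearEquiv.coe_mk, LinearMap.coe_mk, AddHom.coe_mk]
  ring

theorem columnEval_last (hk : 0 < k) (f : F[X]) :
    columnEval k m a b c lam f (Fin.last (m + 1)) = f.coeff (k - 1) := by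
  rw [columnEval, Finset.sum_eq_single (⟨k - 1, by omega⟩ : Fin k)]
  · simp [G1matInf]
  · intro s _ hs
    have : (s : ℕ) ≠ k - 1 := fun h => hs (Fin.ext h)
    simp [G1matInf, this]
  · simp

theorem colsIndep_G1matInf_iff_columnEval :
    colsIndep (G1matInf k m a b c lam) ↔
      ∀ T : Finset (Fin (m + 2)), T.card = k → ∀ f : F[X], f.degree < k →
        (∀ j ∈ T, columnEval k m a b c lam f j = 0) → f = 0 := by
  constructor
  · intro h T hT f hf hfT
    by_contra hf0
    refine h _ (T.orderEmbOfFin hT).injective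
      (exists_vecMul_eq_zero_iff.1 ⟨fun s => f.coeff s, fun h0 => hf0 ?_, ?_⟩)
    · ext n
      by_cases hn : n < k
      · exact congrFun h0 ⟨n, hn⟩
      · exact coeff_eq_zero_of_degree_lt (hf.trans_le (by exact_mod_cast not_lt.1 hn))
    · ext i
      exact hfT _ (T.orderEmbOfFin_mem hT i)
  · intro h e he hdet
    obtain ⟨v, hv, hv0⟩ := exists_vecMul_eq_zero_iff.2 hdet
    set f := (degreeLTEquiv F k).symm v with hfdef
    have hcoeff : ∀ s : Fin k, (f : F[X]).coeff s = v s := fun s =>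
      congrFun ((degreeLTEquiv F k).apply_symm_apply v) s
    have hf0 : (f : F[X]) = 0 := by
      refine h (Finset.univ.map ⟨e, he⟩) (by simp) f (mem_degreeLT.1 f.2) fun j hj => ?_
      obtain ⟨i, -, rfl⟩ := Finset.mem_map.1 hj
      simp only [columnEval, hcoeff]
      exact congrFun hv0 i
    refine hv (funext fun s => ?_)
    rw [← hcoeff, hf0, coeff_zero, Pi.zero_apply]

theorem forall_strictMono_prod_iff_forall_finset {P : ℕ → Prop} :
    (∀ s, P s → ∀ e : Fin s → Fin m, StrictMono e →
        (∏ j, (b - a (e j))) - lam * ∏ j, (c - a (e j)) ≠ 0) ↔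
      ∀ S : Finset (Fin m), P S.card →
        (∏ i ∈ S, (b - a i)) - lam * ∏ i ∈ S, (c - a i) ≠ 0 := by
  constructor
  · intro h S hS
    have key := h _ hS _ (S.orderEmbOfFin rfl).strictMono
    rwa [← Finset.prod_image (s := univ) (f := fun i => b - a i)
        (S.orderEmbOfFin rfl).injective.injOn,
      ← Finset.prod_image (s := univ) (f := fun i => c - a i)
        (S.orderEmbOfFin rfl).injective.injOn,
      Finset.image_orderEmbOfFin_univ] at key
  · intro h s hs e he
    have key := h (univ.map ⟨e, he.injective⟩) (by simpa using hs)
    simpa using key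

/-- A nonzero polynomial vanishing at `#S` distinct points, of degree at most `#S`, is a nonzero
scalar multiple of the corresponding nodal polynomial. -/
theorem exists_eq_C_mul_prod_X_sub_C {S : Finset (Fin m)} (ha : Function.Injective a) {f : F[X]}
    (hf0 : f ≠ 0) (hdeg : f.natDegree ≤ S.card) (hroot : ∀ i ∈ S, f.eval (a i) = 0) :
    ∃ q : F, q ≠ 0 ∧ f = C q * ∏ i ∈ S, (X - C (a i)) := by
  have hdvd : ∏ i ∈ S, (X - C (a i)) ∣ f :=
    Finset.prod_dvd_of_coprime
      (fun i _ j _ hij => pairwise_coprime_X_sub_C ha hij)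
      fun i hi => dvd_iff_isRoot.2 (hroot i hi)
  have hP : (∏ i ∈ S, (X - C (a i))).Monic := monic_prod_X_sub_C _ _
  refine ⟨f.leadingCoeff, leadingCoeff_ne_zero.2 hf0,
    eq_leadingCoeff_mul_of_monic_of_dvd_of_natDegree_le hP hdvd ?_⟩
  simpa using hdeg

theorem card_eq_card_filter_castSucc (T : Finset (Fin (m + 2))) :
    T.card = (univ.filter fun i : Fin m => i.castSucc.castSucc ∈ T).card +
      (if (Fin.last m).castSucc ∈ T then 1 else 0) + (if Fin.last (m + 1) ∈ T then 1 else 0) := by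
  rw [← Finset.filter_univ_mem T, Finset.card_filter, Finset.card_filter,
    Fin.sum_univ_castSucc, Fin.sum_univ_castSucc]
  simp

end

/-- For `2 ≤ k ≤ n-1` (here `n = m+1`), the code `C_1(b,c,∞)` is MDS,
i.e. every `k` columns of `G_1(b,c,∞)` are linearly independent, iff for every
`s ∈ {k-2, k-1}` and all `1 ≤ i_1 < ⋯ < i_s ≤ n-1` one has
`∏ (b - a_{i_j}) - λ ∏ (c - a_{i_j}) ≠ 0`. -/
theorem C1inf_MDS_iff {F : Type*} [Field F] [Fintype F] (m k : ℕ)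
    (hk1 : 2 ≤ k) (hkm : k ≤ m)
    (a : Fin m → F) (b c lam : F)
    (hainj : Function.Injective a) (hab : ∀ i, a i ≠ b) (hac : ∀ i, a i ≠ c)
    (hbc : b ≠ c) :
    colsIndep (G1matInf k m a b c lam) ↔
      ∀ s ∈ ({k - 2, k - 1} : Set ℕ), ∀ e : Fin s → Fin m, StrictMono e →
        (∏ j, (b - a (e j))) - lam * ∏ j, (c - a (e j)) ≠ 0 := by
  rw [colsIndep_G1matInf_iff_columnEval, forall_strictMono_prod_iff_forall_finset]
  constructor
  · intro h S hS h0
    set f : Polynomial F := ∏ i ∈ S, (Polynomial.X - Polynomial.C (a i)) with hfdef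
    have hmonic : f.Monic := Polynomial.monic_prod_X_sub_C _ _
    have hdeg : f.natDegree = S.card := by simp [hfdef]
    have hS' : S.card = k - 2 ∨ S.card = k - 1 := hS
    have hlt : f.degree < k := by
      rw [← Polynomial.natDegree_lt_iff_degree_lt hmonic.ne_zero]
      omega
    classical
    let T : Finset (Fin (m + 2)) := univ.filter fun j => columnEval k m a b c lam f j = 0
    have hcard : k ≤ T.card := by
      have hsub : S ⊆ univ.filter fun i : Fin m => i.castSucc.castSucc ∈ T := fun i hi => by
        simp only [T, mem_filter, mem_univ, true_and]
        rw [columnEval_castSucc_castSucc hlt, hfdef, Polynomial.eval_prod]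
        exact Finset.prod_eq_zero hi (by simp)
      have hm : (Fin.last m).castSucc ∈ T := by
        simp only [T, mem_filter, mem_univ, true_and]
        rw [columnEval_castSucc_last hlt, hfdef, Polynomial.eval_prod, Polynomial.eval_prod]
        simpa using h0
      have hle := Finset.card_le_card hsub
      rw [card_eq_card_filter_castSucc T, if_pos hm]
      rcases hS' with hS' | hS'
      · have hlast : Fin.last (m + 1) ∈ T := by
          simp only [T, mem_filter, mem_univ, true_and]
          rw [columnEval_last (by omega)]
          exact Polynomial.coeff_eq_zero_of_natDegree_lt (by omega)
        rw [if_pos hlast]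
        omega
      · omega
    obtain ⟨U, hUT, hU⟩ := Finset.exists_subset_card_eq hcard
    exact hmonic.ne_zero (h U hU f hlt fun j hj => (mem_filter.1 (hUT hj)).2)
  · intro h T hT f hf hfT
    by_contra hf0
    have hnat : f.natDegree < k := (Polynomial.natDegree_lt_iff_degree_lt hf0).2 hf
    have hcard := card_eq_card_filter_castSucc T
    set S := univ.filter fun i : Fin m => i.castSucc.castSucc ∈ T with hSdef
    have hroot : ∀ i ∈ S, f.eval (a i) = 0 := fun i hi => by
      rw [← columnEval_castSucc_castSucc (b := b) (c := c) (lam := lam) hf]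
      exact hfT _ (mem_filter.1 hi).2
    have hlast : Fin.last (m + 1) ∈ T → f.natDegree < k - 1 := fun hmem => by
      have hcoeff := hfT _ hmem
      rw [columnEval_last (by omega)] at hcoeff
      have hne : f.natDegree ≠ k - 1 := fun heq =>
        hf0 (Polynomial.leadingCoeff_eq_zero.1 (by rwa [Polynomial.leadingCoeff, heq]))
      omega
    have hdeg : f.natDegree ≤ S.card := by
      by_cases h2 : Fin.last (m + 1) ∈ T
      · have := hlast h2
        split_ifs at hcard <;> omega
      · split_ifs at hcard <;> omega
    obtain ⟨q, hq, hfq⟩ := exists_eq_C_mul_prod_X_sub_C hainj hf0 hdeg hroot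
    have hdeg' : f.natDegree = S.card := by
      rw [hfq, Polynomial.natDegree_C_mul hq]
      simp
    have hm : (Fin.last m).castSucc ∈ T := by
      by_contra hm
      rw [if_neg hm] at hcard
      split_ifs at hcard with h2
      · have := hlast h2
        omega
      · omega
    rw [if_pos hm] at hcard
    have hS : S.card ∈ ({k - 2, k - 1} : Set ℕ) := by
      simp only [Set.mem_insert_iff, Set.mem_singleton_iff]
      split_ifs at hcard <;> omega
    have hval := hfT _ hm
    rw [columnEval_castSucc_last hf, hfq] at hval
    simp only [Polynomial.eval_mul, Polynomial.eval_C, Polynomial.eval_prod,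
      Polynomial.eval_sub, Polynomial.eval_X] at hval
    refine h S hS ((mul_eq_zero.1 ?_).resolve_left hq)
    linear_combination hval
end

section
/- Assume the subgroup construction with 1 ≤ k ≤ n−1 and λ ∉ H. Then every k columns of G_1(b,c) are linearly independent; that is, C_1(b,c) is an MDS code of length n, dimension k, and minimum Hamming distance n − k + 1. -/
open Matrix Finset

open Polynomial in
/-- A polynomial vanishing at the nodes `a i`, `i ∈ T`, and twisted by `lam` between `b` and `c`
is zero as soon as `lam` differs from the quotient `∏ (b - a i) / ∏ (c - a i)`. -/
theorem Polynomial.eq_zero_of_degree_le_of_twisted {F ι : Type*} [Field F] {a : ι → F}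
    (ha : Function.Injective a) {b c lam : F} {T : Finset ι} (hc : ∀ i ∈ T, c ≠ a i)
    (hlam : ∏ i ∈ T, (b - a i) ≠ lam * ∏ i ∈ T, (c - a i)) {f : F[X]}
    (hdeg : f.degree < (#T + 1 : ℕ)) (hT : ∀ i ∈ T, f.eval (a i) = 0)
    (hf : f.eval b = lam * f.eval c) : f = 0 := by
  classical
  have hcard : #(insert c (T.image a)) = #T + 1 := by
    rw [card_insert_of_notMem, card_image_of_injective _ ha]
    simpa [eq_comm] using hc
  have hpc : (Lagrange.nodal T a).eval c ≠ 0 := Lagrange.eval_nodal_not_at_node hc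
  have key : C ((Lagrange.nodal T a).eval c) * f = C (f.eval c) * Lagrange.nodal T a := by
    refine sub_eq_zero.mp
      (eq_zero_of_degree_lt_of_eval_finset_eq_zero (insert c (T.image a)) ?_ ?_)
    · rw [hcard]
      refine (degree_sub_le _ _).trans_lt (max_lt ?_ ?_)
      · rwa [degree_C_mul hpc]
      · rw [C_mul']
        refine (degree_smul_le _ _).trans_lt ?_
        rw [Lagrange.degree_nodal]
        exact_mod_cast Nat.lt_succ_self _
    · intro x hx
      rcases Finset.mem_insert.mp hx with rfl | hx
      · simp [mul_comm]
      · obtain ⟨i, hi, rfl⟩ := Finset.mem_image.mp hx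
        simp [hT i hi, Lagrange.eval_nodal_at_node hi]
  have hfc : f.eval c = 0 := by
    have hb := congrArg (eval b) key
    simp only [eval_mul, eval_C, hf, Lagrange.eval_nodal] at hb
    by_contra h
    exact hlam (mul_left_cancel₀ h (by linear_combination -hb))
  rw [hfc, C_0, zero_mul] at key
  exact (mul_eq_zero.mp key).resolve_left (C_ne_zero.mpr hpc)

open Polynomial in
theorem vecMul_G1mat_castSucc {F : Type*} [Field F] {k m : ℕ} (a : Fin m → F) (b c lam : F)
    (v : Fin k → F) (j : Fin m) :
    (v ᵥ* G1mat k m a b c lam) j.castSucc = (∑ s, C (v s) * X ^ (s : ℕ)).eval (a j) := by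
  simp [Matrix.vecMul, dotProduct, G1mat, eval_finsetSum]

open Polynomial in
theorem vecMul_G1mat_last {F : Type*} [Field F] {k m : ℕ} (a : Fin m → F) (b c lam : F)
    (v : Fin k → F) :
    (v ᵥ* G1mat k m a b c lam) (Fin.last m) =
      (∑ s, C (v s) * X ^ (s : ℕ)).eval b - lam * (∑ s, C (v s) * X ^ (s : ℕ)).eval c := by
  simp [Matrix.vecMul, dotProduct, G1mat, eval_finsetSum, mul_sub, Finset.sum_sub_distrib,
    Finset.mul_sum, mul_left_comm]

open Polynomial in
theorem colsIndep_G1mat {F : Type*} [Field F] {k m : ℕ} {a : Fin m → F} {b c lam : F}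
    (ha : Function.Injective a) (hc : ∀ i, c ≠ a i)
    (hlam : ∀ T : Finset (Fin m), ∏ i ∈ T, (b - a i) ≠ lam * ∏ i ∈ T, (c - a i)) :
    colsIndep (G1mat k m a b c lam) := by
  classical
  intro e he hdet
  obtain ⟨v, hv, hv0⟩ := Matrix.exists_vecMul_eq_zero_iff.mpr hdet
  have hcol (i : Fin k) : (v ᵥ* G1mat k m a b c lam) (e i) = 0 := congrFun hv0 i
  set f : F[X] := ∑ s, C (v s) * X ^ (s : ℕ) with hf
  have hdeg : f.degree < k := degree_sum_fin_lt v
  have hf0 : f ≠ 0 := by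
    intro h
    refine hv (funext fun s => ?_)
    have := congrArg (coeff · (s : ℕ)) h
    simpa [hf, finsetSum_coeff, coeff_X_pow, Fin.val_inj] using this
  let T : Finset (Fin m) := {i | f.eval (a i) = 0}
  have hT : ∀ i ∈ T, f.eval (a i) = 0 := fun i hi => by simpa [T] using hi
  have hrange (i : Fin k) : e i = Fin.last m ∨ e i ∈ T.map Fin.castSuccEmb := by
    have hi := hcol i
    revert hi
    refine Fin.lastCases (fun _ => .inl rfl) (fun j hi => .inr ?_) (e i)
    rw [vecMul_G1mat_castSucc] at hi
    simpa [T] using hi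
  by_cases hlast : ∃ i, e i = Fin.last m
  · obtain ⟨i, hi⟩ := hlast
    have hk : k ≤ #T + 1 := by
      have hsub : univ.image e ⊆ insert (Fin.last m) (T.map Fin.castSuccEmb) := by
        intro x hx
        obtain ⟨i, -, rfl⟩ := Finset.mem_image.mp hx
        exact Finset.mem_insert.mpr (hrange i)
      simpa [card_image_of_injective _ he] using
        (card_le_card hsub).trans (card_insert_le _ _)
    refine hf0 (eq_zero_of_degree_le_of_twisted ha (fun i _ => hc i) (hlam T)
      (hdeg.trans_le (by exact_mod_cast hk)) hT ?_)
    have := hcol i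
    rwa [hi, vecMul_G1mat_last, sub_eq_zero] at this
  · have hk : k ≤ #T := by
      have hsub : univ.image e ⊆ T.map Fin.castSuccEmb := by
        intro x hx
        obtain ⟨i, -, rfl⟩ := Finset.mem_image.mp hx
        exact (hrange i).resolve_left fun h => hlast ⟨i, h⟩
      simpa [card_image_of_injective _ he] using card_le_card hsub
    exact hf0 (eq_zero_of_degree_lt_of_eval_index_eq_zero T ha.injOn
      (hdeg.trans_le (by exact_mod_cast hk)) hT)

theorem mem_rowSpan_iff {F : Type*} [Field F] {k N : ℕ} {G : Matrix (Fin k) (Fin N) F}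
    {x : Fin N → F} : x ∈ rowSpan G ↔ ∃ v, v ᵥ* G = x := by
  rw [rowSpan, show (fun s => G s) = G.row from rfl, ← range_vecMulLinear]
  simp

/-- A nonzero combination of the rows has fewer than `k` zero coordinates. -/
theorem colsIndep.card_zeros_lt {F : Type*} [Field F] [DecidableEq F] {k N : ℕ}
    {G : Matrix (Fin k) (Fin N) F} (hG : colsIndep G) {v : Fin k → F} (hv : v ≠ 0) :
    #{j | (v ᵥ* G) j = 0} < k := by
  by_contra! h
  obtain ⟨S, hS, hcard⟩ := exists_subset_card_eq h
  refine hG (S.orderEmbOfFin hcard) (S.orderEmbOfFin hcard).injective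
    (Matrix.exists_vecMul_eq_zero_iff.mp ⟨v, hv, funext fun i => ?_⟩)
  have := hS (S.orderEmbOfFin_mem hcard i)
  exact (Finset.mem_filter.mp this).2

theorem colsIndep.vecMul_ne_zero {F : Type*} [Field F] {k N : ℕ}
    {G : Matrix (Fin k) (Fin N) F} (hG : colsIndep G) (hkN : k ≤ N) {v : Fin k → F}
    (hv : v ≠ 0) : v ᵥ* G ≠ 0 := by
  classical
  intro h
  have := hG.card_zeros_lt hv
  simp [h] at this
  omega

theorem colsIndep.finrank_rowSpan {F : Type*} [Field F] {k N : ℕ}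
    {G : Matrix (Fin k) (Fin N) F} (hG : colsIndep G) (hkN : k ≤ N) :
    Module.finrank F (rowSpan G) = k := by
  have hinj : Function.Injective G.vecMulLinear := by
    rw [← LinearMap.ker_eq_bot, LinearMap.ker_eq_bot']
    intro v hv
    by_contra h
    exact hG.vecMul_ne_zero hkN h hv
  rw [rowSpan, show (fun s => G s) = G.row from rfl, ← range_vecMulLinear,
    LinearMap.finrank_range_of_inj hinj, Module.finrank_fin_fun]

theorem hammingNorm_add_card_zeros {F : Type*} [Zero F] [DecidableEq F] {N : ℕ}
    (x : Fin N → F) : hammingNorm x + #{j | x j = 0} = N := by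
  rw [hammingNorm, add_comm]
  simpa using card_filter_add_card_filter_not (s := univ) fun j => x j = 0

/-- Any `k - 1` coordinates vanish on some nonzero combination of the `k` rows. -/
theorem exists_ne_zero_vecMul_eq_zero_on {F : Type*} [Field F] {k N : ℕ}
    (G : Matrix (Fin k) (Fin N) F) {S : Finset (Fin N)} (hS : #S < k) :
    ∃ v ≠ 0, ∀ j ∈ S, (v ᵥ* G) j = 0 := by
  have h : LinearMap.ker (G.submatrix id ((↑) : S → Fin N)).vecMulLinear ≠ ⊥ :=
    LinearMap.ker_ne_bot_of_finrank_lt (by simpa using hS)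
  obtain ⟨v, hv, hv0⟩ := Submodule.exists_mem_ne_zero_of_ne_bot h
  exact ⟨v, hv0, fun j hj => congrFun (LinearMap.mem_ker.mp hv) ⟨j, hj⟩⟩

theorem colsIndep.minDist_rowSpan {F : Type*} [Field F] [DecidableEq F] {k N : ℕ}
    {G : Matrix (Fin k) (Fin N) F} (hG : colsIndep G) (hk : 1 ≤ k) (hkN : k ≤ N) :
    minDist (rowSpan G) = N - k + 1 := by
  have hlower : ∀ v ≠ 0, N - k + 1 ≤ hammingNorm (v ᵥ* G) := by
    intro v hv
    have := hammingNorm_add_card_zeros (v ᵥ* G)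
    have := hG.card_zeros_lt hv
    omega
  refine IsLeast.csInf_eq ⟨?_, ?_⟩
  · obtain ⟨S, -, hS⟩ := exists_subset_card_eq (s := (univ : Finset (Fin N))) (n := k - 1)
      (by simp; omega)
    obtain ⟨v, hv, hvS⟩ := exists_ne_zero_vecMul_eq_zero_on G (S := S) (by omega)
    refine ⟨v ᵥ* G, mem_rowSpan_iff.mpr ⟨v, rfl⟩, hG.vecMul_ne_zero hkN hv,
      le_antisymm ?_ (hlower v hv)⟩
    have hsub : S ⊆ ({j | (v ᵥ* G) j = 0} : Finset (Fin N)) := fun j hj => by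
      simpa using hvS j hj
    have := card_le_card hsub
    have := hammingNorm_add_card_zeros (v ᵥ* G)
    omega
  · rintro d ⟨x, hx, hx0, rfl⟩
    obtain ⟨v, rfl⟩ := mem_rowSpan_iff.mp hx
    exact hlower v (by rintro rfl; simp at hx0)

/-- Subgroup construction (`n = m+1`): `H ≤ Fˣ`, the `μ_i` are pairwise
distinct elements of `H \ {1}`, `b ≠ c`, `a_i = (b - μ_i c)/(1 - μ_i)`, and `λ ∉ H`.
Then for `1 ≤ k ≤ n-1` every `k` columns of `G_1(b,c)` are linearly independent;
that is, `C_1(b,c)` is an MDS code of length `n`, dimension `k`, and minimum Hamming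
distance `n - k + 1`. -/
theorem C1_subgroup_MDS {F : Type*} [Field F] [Fintype F] [DecidableEq F] (m k : ℕ)
    (hk1 : 1 ≤ k) (hkm : k ≤ m)
    (H : Subgroup Fˣ) (μ : Fin m → Fˣ)
    (hμH : ∀ i, μ i ∈ H) (hμ1 : ∀ i, μ i ≠ 1) (hμinj : Function.Injective μ)
    (b c lam : F) (hbc : b ≠ c)
    (hlam : ∀ u : Fˣ, u ∈ H → (u : F) ≠ lam)
    (a : Fin m → F) (ha : ∀ i, a i = (b - (μ i : F) * c) / (1 - (μ i : F))) :
    colsIndep (G1mat k m a b c lam) ∧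
      Module.finrank F (rowSpan (G1mat k m a b c lam)) = k ∧
      minDist (rowSpan (G1mat k m a b c lam)) = (m + 1) - k + 1 := by
  have hμ (i : Fin m) : 1 - (μ i : F) ≠ 0 :=
    sub_ne_zero.mpr fun h => hμ1 i (Units.ext h.symm)
  have hca (i : Fin m) : c - a i = (c - b) / (1 - μ i) := by
    rw [ha, eq_div_iff (hμ i), sub_mul, div_mul_cancel₀ _ (hμ i)]
    ring
  have hba (i : Fin m) : b - a i = μ i * (c - a i) := by
    rw [ha]
    field_simp [hμ i]
    ring
  have hc (i : Fin m) : c - a i ≠ 0 := by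
    rw [hca]
    exact div_ne_zero (sub_ne_zero.mpr hbc.symm) (hμ i)
  have hinj : Function.Injective a := by
    intro i j hij
    refine hμinj (Units.ext (mul_right_cancel₀ (hc i) ?_))
    rw [← hba, hij, hba]
  have hG : colsIndep (G1mat k m a b c lam) := by
    refine colsIndep_G1mat hinj (fun i => sub_ne_zero.mp (hc i)) fun T h => ?_
    refine hlam (∏ i ∈ T, μ i) (H.prod_mem fun i _ => hμH i) ?_
    refine mul_right_cancel₀ (Finset.prod_ne_zero_iff.mpr fun i (_ : i ∈ T) => hc i) ?_
    rw [← h, Units.coe_prod, ← Finset.prod_mul_distrib]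
    exact Finset.prod_congr rfl fun i _ => (hba i).symm
  exact ⟨hG, hG.finrank_rowSpan (by omega), hG.minDist_rowSpan hk1 (by omega)⟩
end

section
/- Assume 3 ≤ k, 2k ≤ n, λ ≠ 0, b ≠ c, and that a_1, …, a_{n−1}, b, c are pairwise distinct. Then the Schur square code C_1(b,c)^2 has dimension at least 2k over F. -/
open Matrix Finset

/-- The first `N ≤ m` monomials evaluated at `m` distinct points are linearly independent. -/
lemma linearIndependent_pow_of_injective {F : Type*} [Field F] {m N : ℕ} (hN : N ≤ m)
    {a : Fin m → F} (ha : Function.Injective a) :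
    LinearIndependent F fun (t : Fin N) (j : Fin m) => a j ^ (t : ℕ) :=
  (Matrix.linearIndependent_cols_of_det_ne_zero (Matrix.det_vandermonde_ne_zero_iff.mpr ha)).comp
    (Fin.castLE hN) (Fin.castLE_injective hN)

/-- A linear map with `f ∘ v` independent and a nonzero vector of `ker f` force independence of
the extended family. -/
lemma linearIndependent_snoc_of_comp {K V W : Type*} [Field K] [AddCommGroup V] [Module K V]
    [AddCommGroup W] [Module K W] {n : ℕ} (f : V →ₗ[K] W) {v : Fin n → V} {x : V}
    (hv : LinearIndependent K (f ∘ v)) (hfx : f x = 0) (hx : x ≠ 0) :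
    LinearIndependent K (Fin.snoc v x : Fin (n + 1) → V) := by
  refine linearIndependent_finSnoc.mpr ⟨LinearIndependent.of_comp f hv, fun hmem => hx ?_⟩
  obtain ⟨g, rfl⟩ := (Submodule.mem_span_range_iff_exists_fun K).mp hmem
  have hg := Fintype.linearIndependent_iff.mp hv g (by simpa using hfx)
  simp [hg]

lemma mul_mem_schurMul_rowSpan {F : Type*} [Field F] {k N : ℕ} (G : Matrix (Fin k) (Fin N) F)
    (s t : Fin k) : G s * G t ∈ schurMul (rowSpan G) (rowSpan G) :=
  Submodule.subset_span
    ⟨_, Submodule.subset_span ⟨s, rfl⟩, _, Submodule.subset_span ⟨t, rfl⟩, rfl⟩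

/-- For `3 ≤ k`, `2k ≤ n` (here `n = m+1`), `λ ≠ 0`, `b ≠ c` and
pairwise distinct `a_1,…,a_{n-1}, b, c`, the Schur square of `C_1(b,c)` has
dimension at least `2k`. -/
theorem C1_schur_square_dim_ge {F : Type*} [Field F] [Fintype F] (m k : ℕ)
    (hk3 : 3 ≤ k) (hkn : 2 * k ≤ m + 1)
    (a : Fin m → F) (b c lam : F) (hlam : lam ≠ 0) (hbc : b ≠ c)
    (hainj : Function.Injective a) (hab : ∀ i, a i ≠ b) (hac : ∀ i, a i ≠ c) :
    2 * k ≤ Module.finrank F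
      (schurMul (rowSpan (G1mat k m a b c lam)) (rowSpan (G1mat k m a b c lam))) := by
  set G := G1mat k m a b c lam with hG
  set S := schurMul (rowSpan G) (rowSpan G)
  let f : (Fin (m + 1) → F) →ₗ[F] (Fin m → F) := LinearMap.funLeft F F Fin.castSucc
  let v : Fin (2 * k - 1) → Fin (m + 1) → F := fun t =>
    G ⟨min (t : ℕ) (k - 1), by omega⟩ * G ⟨t - min (t : ℕ) (k - 1), by omega⟩
  let x : Fin (m + 1) → F :=
    G ⟨0, by omega⟩ * G ⟨2, by omega⟩ - G ⟨1, by omega⟩ * G ⟨1, by omega⟩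
  have hv : LinearIndependent F (f ∘ v) := by
    convert linearIndependent_pow_of_injective (N := 2 * k - 1) (by omega) hainj using 1
    ext t j
    simp only [f, v, hG, Function.comp_apply, LinearMap.funLeft_apply, Pi.mul_apply,
      G1mat_castSucc, ← pow_add]
    congr 1
    omega
  have hfx : f x = 0 := by
    ext j
    simp only [f, x, hG, LinearMap.funLeft_apply, Pi.sub_apply, Pi.mul_apply, G1mat_castSucc,
      Pi.zero_apply]
    ring
  have hx : x ≠ 0 := by
    intro h
    have hlast : -(lam * (b - c) ^ 2) = 0 := by
      refine Eq.trans ?_ (congrFun h (Fin.last m))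
      simp only [x, hG, Pi.sub_apply, Pi.mul_apply, G1mat_last]
      ring
    exact neg_ne_zero.mpr (mul_ne_zero hlam (pow_ne_zero 2 (sub_ne_zero.mpr hbc))) hlast
  have hli := linearIndependent_snoc_of_comp f hv hfx hx
  have hle : Submodule.span F (Set.range (Fin.snoc v x : Fin (2 * k - 1 + 1) → _)) ≤ S := by
    rw [Submodule.span_le, Set.range_subset_iff]
    refine Fin.lastCases ?_ fun t => ?_
    · rw [Fin.snoc_last]
      exact S.sub_mem (mul_mem_schurMul_rowSpan _ _ _) (mul_mem_schurMul_rowSpan _ _ _)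
    · rw [Fin.snoc_castSucc]
      exact mul_mem_schurMul_rowSpan _ _ _
  have hcard := finrank_span_eq_card hli
  rw [Fintype.card_fin] at hcard
  have := Submodule.finrank_mono hle
  omega
end

section
/- Assume 3 ≤ k, 2k ≤ n, λ ≠ 0, b ≠ c, and that a_1, …, a_{n−1}, b, c are pairwise distinct. Then C_1(b,c) is not equivalent to RS_{k,n}(a') for any pairwise distinct a'_1, …, a'_n ∈ F, and C_1(b,c) is not equivalent to the extended code RS_{k,n−1}(a',∞) for any pairwise distinct a'_1, …, a'_{n−1} ∈ F. -/
open Matrix Finset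

open Polynomial in
/-- Every word of a Reed–Solomon code is the evaluation of a polynomial of degree at most `k`. -/
theorem exists_eval_of_mem_RSCode {F : Type*} [Field F] {k N : ℕ} {a : Fin N → F}
    {x : Fin N → F} (hx : x ∈ RSCode (k + 1) N a) :
    ∃ f : F[X], f.natDegree ≤ k ∧ ∀ j, x j = f.eval (a j) := by
  induction hx using Submodule.span_induction with
  | mem x h =>
    obtain ⟨f, hf, rfl⟩ := h
    exact ⟨f, natDegree_le_iff_coeff_eq_zero.2 fun i hi => (degree_lt_iff_coeff_zero _ _).1 hf i hi,
      fun _ => rfl⟩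
  | zero => exact ⟨0, by simp, by simp⟩
  | add x y _ _ hx hy =>
    obtain ⟨f, hf, hfx⟩ := hx
    obtain ⟨g, hg, hgy⟩ := hy
    exact ⟨f + g, natDegree_add_le_of_degree_le hf hg, fun j => by simp [hfx, hgy]⟩
  | smul r x _ hx =>
    obtain ⟨f, hf, hfx⟩ := hx
    exact ⟨r • f, (natDegree_smul_le r f).trans hf, fun j => by simp [hfx]⟩

open Polynomial in
/-- Every word of an extended Reed–Solomon code consists of the values of a polynomial of degree
at most `k`, followed by its coefficient of degree `k`. -/
theorem exists_eval_of_mem_RSextCode {F : Type*} [Field F] {k m : ℕ} {a : Fin m → F}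
    {x : Fin (m + 1) → F} (hx : x ∈ RSextCode (k + 1) (m + 1) a) :
    ∃ f : F[X], f.natDegree ≤ k ∧ (∀ j : Fin m, x j.castSucc = f.eval (a j)) ∧
      x (Fin.last m) = f.coeff k := by
  induction hx using Submodule.span_induction with
  | mem x h =>
    obtain ⟨f, hf, rfl⟩ := h
    exact ⟨f, natDegree_le_iff_coeff_eq_zero.2 fun i hi => (degree_lt_iff_coeff_zero _ _).1 hf i hi,
      fun j => by simp, by simp⟩
  | zero => exact ⟨0, by simp, by simp, by simp⟩
  | add x y _ _ hx hy =>
    obtain ⟨f, hf, hfx, hfx'⟩ := hx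
    obtain ⟨g, hg, hgy, hgy'⟩ := hy
    exact ⟨f + g, natDegree_add_le_of_degree_le hf hg, fun j => by simp [hfx, hgy],
      by simp [hfx', hgy']⟩
  | smul r x _ hx =>
    obtain ⟨f, hf, hfx, hfx'⟩ := hx
    exact ⟨r • f, (natDegree_smul_le r f).trans hf, fun j => by simp [hfx], by simp [hfx']⟩

open Polynomial in
theorem natDegree_mul_sub_sq_le {F : Type*} [Field F] {k : ℕ} {f g h : F[X]}
    (hf : f.natDegree ≤ k) (hg : g.natDegree ≤ k) (hh : h.natDegree ≤ k) :
    (f * h - g ^ 2).natDegree ≤ k + k := by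
  rw [sq]
  exact natDegree_sub_le_of_le (natDegree_mul_le_of_le hf hh) (natDegree_mul_le_of_le hg hg)
    |>.trans (max_self _).le

open Polynomial in
/-- The quadratic expression `x * z - y ^ 2` in words of a Reed–Solomon code of rate at most `1/2`
never has weight one. -/
theorem RSCode_mul_sub_sq_eq_zero {F : Type*} [Field F] {k N : ℕ} {a : Fin N → F}
    (hkN : 2 * (k + 1) ≤ N) (ha : Function.Injective a) {x y z : Fin N → F}
    (hx : x ∈ RSCode (k + 1) N a) (hy : y ∈ RSCode (k + 1) N a) (hz : z ∈ RSCode (k + 1) N a)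
    (i₀ : Fin N) (h : ∀ i ≠ i₀, x i * z i - y i ^ 2 = 0) : x i₀ * z i₀ - y i₀ ^ 2 = 0 := by
  obtain ⟨f, hf, hfx⟩ := exists_eval_of_mem_RSCode hx
  obtain ⟨g, hg, hgy⟩ := exists_eval_of_mem_RSCode hy
  obtain ⟨p, hp, hpz⟩ := exists_eval_of_mem_RSCode hz
  have hcard : #(univ.erase i₀) = N - 1 := by simp
  have hzero : f * p - g ^ 2 = 0 := by
    refine eq_zero_of_degree_lt_of_eval_index_eq_zero (univ.erase i₀) ha.injOn ?_ ?_
    · refine (natDegree_le_iff_degree_le.1 (natDegree_mul_sub_sq_le hf hg hp)).trans_lt ?_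
      rw [hcard]
      exact_mod_cast (by omega : k + k < N - 1)
    · intro i hi
      simpa [hfx, hgy, hpz] using h i (ne_of_mem_erase hi)
  simpa [hfx, hgy, hpz] using congrArg (eval (a i₀)) hzero

open Polynomial in
/-- The quadratic expression `x * z - y ^ 2` in words of an extended Reed–Solomon code of rate at
most `1/2` never has weight one. -/
theorem RSextCode_mul_sub_sq_eq_zero {F : Type*} [Field F] {k m : ℕ} {a : Fin m → F}
    (hkm : 2 * (k + 1) ≤ m + 1) (ha : Function.Injective a) {x y z : Fin (m + 1) → F}
    (hx : x ∈ RSextCode (k + 1) (m + 1) a) (hy : y ∈ RSextCode (k + 1) (m + 1) a)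
    (hz : z ∈ RSextCode (k + 1) (m + 1) a)
    (i₀ : Fin (m + 1)) (h : ∀ i ≠ i₀, x i * z i - y i ^ 2 = 0) :
    x i₀ * z i₀ - y i₀ ^ 2 = 0 := by
  obtain ⟨f, hf, hfx, hfx'⟩ := exists_eval_of_mem_RSextCode hx
  obtain ⟨g, hg, hgy, hgy'⟩ := exists_eval_of_mem_RSextCode hy
  obtain ⟨p, hp, hpz, hpz'⟩ := exists_eval_of_mem_RSextCode hz
  have hdeg := natDegree_mul_sub_sq_le hf hg hp
  have hcoeff : (f * p - g ^ 2).coeff (k + k) =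
      x (Fin.last m) * z (Fin.last m) - y (Fin.last m) ^ 2 := by
    rw [coeff_sub, sq g, coeff_mul_add_eq_of_natDegree_le hf hp,
      coeff_mul_add_eq_of_natDegree_le hg hg, hfx', hgy', hpz', sq]
  induction i₀ using Fin.lastCases with
  | last =>
    have hzero : f * p - g ^ 2 = 0 := by
      refine eq_zero_of_degree_lt_of_eval_index_eq_zero univ ha.injOn ?_ ?_
      · refine (natDegree_le_iff_degree_le.1 hdeg).trans_lt ?_
        rw [card_univ, Fintype.card_fin]
        exact_mod_cast (by omega : k + k < m)
      · intro i _
        simpa [hfx, hgy, hpz] using h i.castSucc (Fin.castSucc_lt_last i).ne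
    rw [← hcoeff, hzero, coeff_zero]
  | cast j =>
    have htop : (f * p - g ^ 2).coeff (k + k) = 0 :=
      hcoeff.trans (h _ (Fin.castSucc_lt_last j).ne')
    have hlt : (f * p - g ^ 2).degree < ((k + k : ℕ) : WithBot ℕ) :=
      (natDegree_le_iff_degree_le.1 hdeg).lt_of_ne fun he =>
        coeff_ne_zero_of_eq_degree he htop
    have hcard : #(univ.erase j) = m - 1 := by simp
    have hzero : f * p - g ^ 2 = 0 := by
      refine eq_zero_of_degree_lt_of_eval_index_eq_zero (univ.erase j) ha.injOn ?_ ?_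
      · refine hlt.trans_le ?_
        rw [hcard]
        exact_mod_cast (by omega : k + k ≤ m - 1)
      · intro i hi
        simpa [hfx, hgy, hpz] using h i.castSucc (by simpa using ne_of_mem_erase hi)
    simpa [hfx, hgy, hpz] using congrArg (eval (a j)) hzero

/-- The code `C_1(b,c)` is not equivalent to a code in which `x * z - y ^ 2` never has
weight one. -/
theorem not_codeEquiv_rowSpan_G1mat {F : Type*} [Field F] {m k : ℕ} (hk : 3 ≤ k)
    (a : Fin m → F) {b c lam : F} (hlam : lam ≠ 0) (hbc : b ≠ c)
    {D : Submodule F (Fin (m + 1) → F)}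
    (hD : ∀ x ∈ D, ∀ y ∈ D, ∀ z ∈ D, ∀ i₀, (∀ i ≠ i₀, x i * z i - y i ^ 2 = 0) →
      x i₀ * z i₀ - y i₀ ^ 2 = 0) :
    ¬ codeEquiv (rowSpan (G1mat k m a b c lam)) D := by
  rintro ⟨π, v, hv, hCD⟩
  have hrow (s : Fin k) : ∃ x ∈ D, ∀ i, G1mat k m a b c lam s i = v i * x (π i) := by
    have hs : G1mat k m a b c lam s ∈ (rowSpan (G1mat k m a b c lam) : Set (Fin (m + 1) → F)) :=
      Submodule.subset_span ⟨s, rfl⟩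
    rw [hCD] at hs
    obtain ⟨x, hx, hxs⟩ := hs
    exact ⟨x, hx, fun i => (congrFun hxs i).symm⟩
  obtain ⟨x, hxD, hx⟩ := hrow ⟨0, by omega⟩
  obtain ⟨y, hyD, hy⟩ := hrow ⟨1, by omega⟩
  obtain ⟨z, hzD, hz⟩ := hrow ⟨2, by omega⟩
  have key (i : Fin (m + 1)) : v i ^ 2 * (x (π i) * z (π i) - y (π i) ^ 2) =
      G1mat k m a b c lam ⟨0, by omega⟩ i * G1mat k m a b c lam ⟨2, by omega⟩ i -
        G1mat k m a b c lam ⟨1, by omega⟩ i ^ 2 := by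
    rw [hx, hy, hz]
    ring
  have hlast : x (π (Fin.last m)) * z (π (Fin.last m)) - y (π (Fin.last m)) ^ 2 = 0 := by
    refine hD x hxD y hyD z hzD _ fun i hi => ?_
    obtain ⟨j, rfl⟩ := π.surjective i
    induction j using Fin.lastCases with
    | last => exact absurd rfl hi
    | cast j =>
      refine (mul_eq_zero.1 ((key j.castSucc).trans ?_)).resolve_left (pow_ne_zero 2 (hv _))
      simp [G1mat]
  have hkey := key (Fin.last m)
  rw [hlast, mul_zero] at hkey
  have hprod : lam * (b - c) ^ 2 = 0 := by
    simp only [G1mat, Matrix.of_apply, Fin.val_last, lt_irrefl, dite_false] at hkey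
    linear_combination hkey
  exact mul_ne_zero hlam (pow_ne_zero 2 (sub_ne_zero.2 hbc)) hprod

/-- For `3 ≤ k`, `2k ≤ n` (here `n = m+1`), `λ ≠ 0`, `b ≠ c` and
pairwise distinct `a_1,…,a_{n-1}, b, c`, the code `C_1(b,c)` is not equivalent to
`RS_{k,n}(a')` for any pairwise distinct `a'_1,…,a'_n`, nor to the extended code
`RS_{k,n-1}(a',∞)` for any pairwise distinct `a'_1,…,a'_{n-1}`. -/
theorem C1_not_equiv_RS {F : Type*} [Field F] [Fintype F] (m k : ℕ)
    (hk3 : 3 ≤ k) (hkn : 2 * k ≤ m + 1)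
    (a : Fin m → F) (b c lam : F) (hlam : lam ≠ 0) (hbc : b ≠ c)
    (hainj : Function.Injective a) (hab : ∀ i, a i ≠ b) (hac : ∀ i, a i ≠ c) :
    (∀ a' : Fin (m + 1) → F, Function.Injective a' →
        ¬ codeEquiv (rowSpan (G1mat k m a b c lam)) (RSCode k (m + 1) a')) ∧
    (∀ a' : Fin m → F, Function.Injective a' →
        ¬ codeEquiv (rowSpan (G1mat k m a b c lam)) (RSextCode k (m + 1) a')) := by
  obtain ⟨k, rfl⟩ : ∃ l, k = l + 1 := ⟨k - 1, by omega⟩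
  exact ⟨fun a' ha' => not_codeEquiv_rowSpan_G1mat hk3 a hlam hbc
      fun _ hx _ hy _ hz => RSCode_mul_sub_sq_eq_zero hkn ha' hx hy hz,
    fun a' ha' => not_codeEquiv_rowSpan_G1mat hk3 a hlam hbc
      fun _ hx _ hy _ hz => RSextCode_mul_sub_sq_eq_zero hkn ha' hx hy hz⟩
end

section
/- Assume 2 ≤ k ≤ n−1. The code C_2(b,c) is MDS (equivalently, every k columns of G_2(b,c) are linearly independent) if and only if for all indices 1 ≤ i_1 < i_2 < ⋯ < i_{k−1} ≤ n−1 one has both ∏_{j=1}^{k−1}(b − a_{i_j}) − λ_1 ∏_{j=1}^{k−1}(c − a_{i_j}) ≠ 0 and ∏_{j=1}^{k−1}(b − a_{i_j}) − λ_2 ∏_{j=1}^{k−1}(c − a_{i_j}) ≠ 0. -/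
open Matrix Finset

open Polynomial in
/-- The value at the column `j` of `G2mat` of the codeword given by the polynomial `f`. -/
def twistedEval {F : Type*} [Field F] {m : ℕ} (a : Fin m → F) (b c l1 l2 : F) (f : F[X])
    (j : Fin (m + 2)) : F :=
  if h : (j : ℕ) < m then f.eval (a ⟨j, h⟩)
  else if (j : ℕ) = m then f.eval b - l1 * f.eval c
  else f.eval b - l2 * f.eval c

open Polynomial in
theorem Polynomial.eval_eq_sum_fin {R : Type*} [CommSemiring R] {k : ℕ} {f : R[X]}
    (hf : f.degree < k) (x : R) : f.eval x = ∑ s : Fin k, f.coeff s * x ^ (s : ℕ) := by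
  rcases eq_or_ne f 0 with rfl | h0
  · simp
  · rw [eval_eq_sum_range' ((natDegree_lt_iff_degree_lt h0).2 hf),
      Fin.sum_univ_eq_sum_range (fun s => f.coeff s * x ^ s)]

open Polynomial in
theorem coeff_vecMul_G2mat {F : Type*} [Field F] {k m : ℕ} (a : Fin m → F) (b c l1 l2 : F)
    {f : F[X]} (hf : f.degree < k) :
    (fun s : Fin k => f.coeff s) ᵥ* G2mat k m a b c l1 l2 = twistedEval a b c l1 l2 f := by
  funext j
  simp only [Matrix.vecMul, dotProduct, G2mat, Matrix.of_apply, twistedEval,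
    eval_eq_sum_fin hf]
  split_ifs <;>
    simp only [mul_sub, Finset.sum_sub_distrib, Finset.mul_sum, mul_left_comm]

open Polynomial in
theorem det_G2mat_submatrix_ne_zero_iff {F : Type*} [Field F] {k m : ℕ} (a : Fin m → F)
    (b c l1 l2 : F) (e : Fin k → Fin (m + 2)) :
    ((G2mat k m a b c l1 l2).submatrix id e).det ≠ 0 ↔
      ∀ f : F[X], f.degree < k → (∀ i, twistedEval a b c l1 l2 f (e i) = 0) → f = 0 := by
  rw [Ne, ← Matrix.exists_vecMul_eq_zero_iff]
  push Not
  constructor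
  · intro h f hf hz
    by_contra hne
    refine h (fun s => f.coeff s) (fun h0 => hne ?_) ?_
    · ext n
      by_cases hn : n < k
      · exact congrFun h0 ⟨n, hn⟩
      · exact coeff_eq_zero_of_degree_lt (hf.trans_le (by exact_mod_cast not_lt.1 hn))
    · funext i
      exact (congrFun (coeff_vecMul_G2mat a b c l1 l2 hf) (e i)).trans (hz i)
  · intro h v hv hz
    obtain ⟨f, hf⟩ := (degreeLTEquiv F k).surjective v
    have hd : (f : F[X]).degree < k := mem_degreeLT.1 f.2
    have hv' : (fun s : Fin k => (f : F[X]).coeff s) = v := hf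
    refine hv ?_
    have : (f : F[X]) = 0 := h f hd fun i => by
      rw [← coeff_vecMul_G2mat a b c l1 l2 hd, hv']
      exact congrFun hz i
    rw [← hv', this]
    rfl

open Polynomial in
theorem Polynomial.exists_eq_C_mul_prod_X_sub_C {F ι : Type*} [Field F] {a : ι → F}
    (ha : Function.Injective a) (T : Finset ι) {f : F[X]} (hd : f.degree < (#T + 1 : ℕ))
    (hf : ∀ i ∈ T, f.eval (a i) = 0) : ∃ r : F, f = C r * ∏ i ∈ T, (X - C (a i)) := by
  have hdvd : ∏ i ∈ T, (X - C (a i)) ∣ f :=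
    Finset.prod_dvd_of_coprime (fun _ _ _ _ hij => pairwise_coprime_X_sub_C ha hij)
      fun i hi => dvd_iff_isRoot.2 (hf i hi)
  obtain ⟨q, rfl⟩ := hdvd
  have hq : q.degree ≤ 0 := by
    rw [degree_mul, degree_prod] at hd
    simp only [degree_X_sub_C, sum_const, nsmul_eq_mul, mul_one] at hd
    rcases eq_or_ne q 0 with rfl | h0
    · simp
    · rw [degree_eq_natDegree h0] at hd ⊢
      norm_cast at hd ⊢
      lia
  exact ⟨q.coeff 0, by rw [mul_comm, ← eq_C_of_degree_le_zero hq]⟩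

open Polynomial in
/-- If `e` selects exactly one twisted column `e i₀`, then a polynomial vanishing on the
selected columns is zero, provided the product condition holds. -/
theorem eq_zero_of_single_twisted_column {F : Type*} [Field F] {n m : ℕ} {a : Fin m → F}
    {b c l1 l2 l : F} (hainj : Function.Injective a)
    (hne : ∀ e : Fin n → Fin m, StrictMono e →
      (∏ j, (b - a (e j))) - l * ∏ j, (c - a (e j)) ≠ 0)
    {e : Fin (n + 1) → Fin (m + 2)} (he : Function.Injective e) {i₀ : Fin (n + 1)}
    (hlt : ∀ i, i ≠ i₀ → (e i : ℕ) < m) {f : F[X]} (hd : f.degree < (n + 1 : ℕ))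
    (hz : ∀ i, twistedEval a b c l1 l2 f (e i) = 0) (hl : f.eval b - l * f.eval c = 0) :
    f = 0 := by
  have hlt' (i : Fin n) := hlt (i₀.succAbove i) (Fin.succAbove_ne i₀ i)
  let g : Fin n → Fin m := fun i => ⟨e (i₀.succAbove i), hlt' i⟩
  have hg : Function.Injective g := fun i j hij =>
    Fin.succAbove_right_injective (he (Fin.ext (Fin.mk.inj_iff.1 hij)))
  have hT : #(univ.image g) = n := by rw [card_image_of_injective _ hg, card_fin]
  obtain ⟨r, hr⟩ := Polynomial.exists_eq_C_mul_prod_X_sub_C hainj (univ.image g) (f := f)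
    (by rwa [hT]) fun i hi => by
      obtain ⟨j, -, rfl⟩ := mem_image.1 hi
      simpa [twistedEval, hlt' j, g] using hz (i₀.succAbove j)
  have hprod (x : F) : f.eval x = r * ∏ j, (x - a ((univ.image g).orderEmbOfFin hT j)) := by
    have h := prod_map univ ((univ.image g).orderEmbOfFin hT).toEmbedding (fun i => x - a i)
    rw [map_orderEmbOfFin_univ] at h
    simp only [hr, eval_mul, eval_C, eval_prod, eval_sub, eval_X, h]
    rfl
  have hne' := hne _ ((univ.image g).orderEmbOfFin hT).strictMono
  have hr0 : r = 0 := by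
    rw [hprod, hprod, mul_left_comm, ← mul_sub] at hl
    exact (mul_eq_zero.1 hl).resolve_right hne'
  rw [hr, hr0, C_0, zero_mul]

open Polynomial in
/-- A polynomial of degree less than `k` vanishing at `k` of the points `a_0, …, a_{m-1}, b, c`
is zero. -/
theorem eq_zero_of_eval_points_eq_zero {F : Type*} [Field F] {k m : ℕ} {a : Fin m → F} {b c : F}
    (hainj : Function.Injective a) (hab : ∀ i, a i ≠ b) (hac : ∀ i, a i ≠ c) (hbc : b ≠ c)
    {e : Fin k → Fin (m + 2)} (he : Function.Injective e) {f : F[X]} (hd : f.degree < k)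
    (hz : ∀ i, f.eval (if h : (e i : ℕ) < m then a ⟨e i, h⟩
      else if (e i : ℕ) = m then b else c) = 0) : f = 0 := by
  let p : Fin (m + 2) → F := fun j =>
    if h : (j : ℕ) < m then a ⟨j, h⟩ else if (j : ℕ) = m then b else c
  have hp : Function.Injective p := by
    intro i j hij
    simp only [p] at hij
    split_ifs at hij with h1 h2 h3 h4 h5 h6 h7 h8
    · exact Fin.ext (Fin.mk.inj_iff.1 (hainj hij))
    all_goals first
      | exact absurd hij (hab _)
      | exact absurd hij (hac _)
      | exact absurd hij.symm (hab _)
      | exact absurd hij.symm (hac _)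
      | exact absurd hij hbc
      | exact absurd hij.symm hbc
      | (ext; lia)
  exact eq_zero_of_degree_lt_of_eval_index_eq_zero univ (v := p ∘ e) (hp.comp he).injOn
    (by simpa using hd) fun i _ => hz i

open Polynomial in
theorem product_ne_zero_of_twisted_column {F : Type*} [Field F] {n m : ℕ} {a : Fin m → F}
    {b c l1 l2 : F} (h : colsIndep (G2mat (n + 1) m a b c l1 l2)) {e : Fin n → Fin m}
    (he : Function.Injective e) {t : Fin (m + 2)} (ht : m ≤ (t : ℕ)) :
    twistedEval a b c l1 l2 (∏ j, (X - C (a (e j)))) t ≠ 0 := by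
  intro h0
  have hinj : Function.Injective
      (Fin.cons t fun j => (e j).castLE (by lia) : Fin (n + 1) → Fin (m + 2)) := by
    refine Fin.cons_injective_iff.2 ⟨?_, (Fin.castLE_injective (by lia)).comp he⟩
    rintro ⟨j, hj⟩
    have := congrArg Fin.val hj
    simp only [Fin.val_castLE] at this
    lia
  have hP : ∏ j, (X - C (a (e j))) ≠ 0 := prod_ne_zero_iff.2 fun j _ => X_sub_C_ne_zero _
  refine hP ((det_G2mat_submatrix_ne_zero_iff a b c l1 l2 _).1 (h _ hinj) _ ?_ fun i => ?_)
  · rw [degree_prod]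
    simp only [degree_X_sub_C, sum_const, card_univ, Fintype.card_fin, nsmul_eq_mul, mul_one]
    exact_mod_cast Nat.lt_succ_self n
  · refine Fin.cases ?_ (fun j => ?_) i
    · simpa using h0
    · simp only [Fin.cons_succ, twistedEval, Fin.val_castLE, (e j).2, dif_pos, Fin.eta]
      rw [eval_prod]
      exact prod_eq_zero (mem_univ j) (by simp)

/-- For `2 ≤ k ≤ n-1` (here `n = m+1`), the code `C_2(b,c)` is MDS,
i.e. every `k` columns of `G_2(b,c)` are linearly independent, iff for all
`1 ≤ i_1 < ⋯ < i_{k-1} ≤ n-1` both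
`∏ (b - a_{i_j}) - λ_1 ∏ (c - a_{i_j}) ≠ 0` and
`∏ (b - a_{i_j}) - λ_2 ∏ (c - a_{i_j}) ≠ 0`. -/
theorem C2_MDS_iff {F : Type*} [Field F] [Fintype F] (m k : ℕ)
    (hk1 : 2 ≤ k) (hkm : k ≤ m)
    (a : Fin m → F) (b c l1 l2 : F) (hl : l1 ≠ l2)
    (hainj : Function.Injective a) (hab : ∀ i, a i ≠ b) (hac : ∀ i, a i ≠ c)
    (hbc : b ≠ c) :
    colsIndep (G2mat k m a b c l1 l2) ↔
      ∀ e : Fin (k - 1) → Fin m, StrictMono e →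
        ((∏ j, (b - a (e j))) - l1 * ∏ j, (c - a (e j)) ≠ 0 ∧
         (∏ j, (b - a (e j))) - l2 * ∏ j, (c - a (e j)) ≠ 0) := by
  obtain ⟨n, rfl⟩ : ∃ n, k = n + 1 := ⟨k - 1, by lia⟩
  change _ ↔ ∀ e : Fin n → Fin m, StrictMono e →
    ((∏ j, (b - a (e j))) - l1 * ∏ j, (c - a (e j)) ≠ 0 ∧
      (∏ j, (b - a (e j))) - l2 * ∏ j, (c - a (e j)) ≠ 0)
  constructor
  · intro h e he
    constructor
    · simpa [twistedEval, Polynomial.eval_prod] using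
        product_ne_zero_of_twisted_column h he.injective (t := ⟨m, by lia⟩) le_rfl
    · simpa [twistedEval, Polynomial.eval_prod] using
        product_ne_zero_of_twisted_column h he.injective (t := ⟨m + 1, by lia⟩) (Nat.le_succ m)
  · intro h e he
    rw [det_G2mat_submatrix_ne_zero_iff]
    intro f hd hz
    by_cases h1 : ∃ i, (e i : ℕ) = m <;> by_cases h2 : ∃ i, (e i : ℕ) = m + 1
    · obtain ⟨i, hi⟩ := h1
      obtain ⟨j, hj⟩ := h2
      have e1 : f.eval b - l1 * f.eval c = 0 := by simpa [twistedEval, hi] using hz i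
      have e2 : f.eval b - l2 * f.eval c = 0 := by simpa [twistedEval, hj] using hz j
      have hc : f.eval c = 0 :=
        (mul_eq_zero.1 (show (l1 - l2) * f.eval c = 0 by linear_combination e2 - e1)).resolve_left
          (sub_ne_zero.2 hl)
      have hb : f.eval b = 0 := by simpa [hc] using e1
      refine eq_zero_of_eval_points_eq_zero hainj hab hac hbc he hd fun s => ?_
      have hs := hz s
      simp only [twistedEval] at hs
      split_ifs at hs ⊢ <;> assumption
    · obtain ⟨i, hi⟩ := h1
      refine eq_zero_of_single_twisted_column hainj (fun e he => (h e he).1) he (i₀ := i)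
        (fun s hs => ?_) hd hz (by simpa [twistedEval, hi] using hz i)
      have h3 : (e s : ℕ) ≠ m := fun h3 => hs (he (Fin.ext (h3.trans hi.symm)))
      have h4 : (e s : ℕ) ≠ m + 1 := fun h4 => h2 ⟨s, h4⟩
      lia
    · obtain ⟨i, hi⟩ := h2
      refine eq_zero_of_single_twisted_column hainj (fun e he => (h e he).2) he (i₀ := i)
        (fun s hs => ?_) hd hz (by simpa [twistedEval, hi] using hz i)
      have h3 : (e s : ℕ) ≠ m + 1 := fun h3 => hs (he (Fin.ext (h3.trans hi.symm)))
      have h4 : (e s : ℕ) ≠ m := fun h4 => h1 ⟨s, h4⟩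
      lia
    · refine eq_zero_of_eval_points_eq_zero hainj hab hac hbc he hd fun s => ?_
      have hs : (e s : ℕ) < m := by
        have h3 : (e s : ℕ) ≠ m + 1 := fun h3 => h2 ⟨s, h3⟩
        have h4 : (e s : ℕ) ≠ m := fun h4 => h1 ⟨s, h4⟩
        lia
      simpa [twistedEval, hs] using hz s
end

section
/- Assume 3 ≤ k ≤ n−1. The code C_2(b,c,∞) is MDS (equivalently, every k columns of G_2(b,c,∞) are linearly independent) if and only if for every s ∈ {k−2, k−1} and all indices 1 ≤ i_1 < i_2 < ⋯ < i_s ≤ n−1 one has both ∏_{j=1}^{s}(b − a_{i_j}) − λ_1 ∏_{j=1}^{s}(c − a_{i_j}) ≠ 0 and ∏_{j=1}^{s}(b − a_{i_j}) − λ_2 ∏_{j=1}^{s}(c − a_{i_j}) ≠ 0. -/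
open Matrix Finset

open Polynomial in
/-- The pairing of the coefficient vector of `f` with a column of powers is evaluation. -/
lemma sum_coeff_mul_pow {F : Type*} [Field F] {k : ℕ} {f : F[X]} (hf : f.degree < k) (x : F) :
    ∑ s : Fin k, f.coeff s * x ^ (s : ℕ) = f.eval x := by
  rcases eq_or_ne f 0 with rfl | h0
  · simp
  · rw [eval_eq_sum_range' ((natDegree_lt_iff_degree_lt h0).2 hf),
      Fin.sum_univ_eq_sum_range (fun i => f.coeff i * x ^ i)]

open Polynomial in
/-- Every `k` columns of `G` are independent iff no nonzero polynomial of degree `< k` has a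
coefficient vector orthogonal to `k` columns, the columns being split into two blocks. -/
lemma colsIndep_iff_forall_polynomial {F : Type*} [Field F] {k m r : ℕ}
    (G : Matrix (Fin k) (Fin (m + r)) F) :
    colsIndep G ↔ ∀ (T : Finset (Fin m)) (U : Finset (Fin r)), #T + #U = k →
      ∀ f : F[X], f.degree < k →
        (∀ i ∈ T, ∑ s : Fin k, f.coeff s * G s (Fin.castAdd r i) = 0) →
        (∀ u ∈ U, ∑ s : Fin k, f.coeff s * G s (Fin.natAdd m u) = 0) → f = 0 := by
  classical
  constructor
  · intro h T U hcard f hf hT hU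
    have hdisj : Disjoint (T.map (Fin.castAddEmb r)) (U.map (Fin.natAddEmb m)) := by
      rw [Finset.disjoint_left]
      intro x hx hy
      obtain ⟨i, -, rfl⟩ := Finset.mem_map.1 hx
      obtain ⟨u, -, hu⟩ := Finset.mem_map.1 hy
      have := congrArg Fin.val hu
      simp at this
      omega
    have hS : #((T.map (Fin.castAddEmb r)).disjUnion (U.map (Fin.natAddEmb m)) hdisj) = k := by
      rw [Finset.card_disjUnion, Finset.card_map, Finset.card_map, hcard]
    obtain ⟨e, he⟩ : ∃ e : Fin k ↪o Fin (m + r), ∀ j, e j ∈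
        (T.map (Fin.castAddEmb r)).disjUnion (U.map (Fin.natAddEmb m)) hdisj :=
      ⟨_, Finset.orderEmbOfFin_mem _ hS⟩
    have hv : (fun s : Fin k => f.coeff s) = 0 := by
      by_contra hne
      refine h e e.injective (exists_vecMul_eq_zero_iff.1 ⟨_, hne, ?_⟩)
      ext j
      simp only [vecMul, dotProduct, submatrix_apply, id_eq, Pi.zero_apply]
      rcases Finset.mem_disjUnion.1 (he j) with hj | hj
      · obtain ⟨i, hi, hij⟩ := Finset.mem_map.1 hj
        simpa [← hij] using hT i hi
      · obtain ⟨u, hu, huj⟩ := Finset.mem_map.1 hj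
        simpa [← huj] using hU u hu
    ext n
    by_cases hn : n < k
    · simpa using congrFun hv ⟨n, hn⟩
    · simpa using (degree_lt_iff_coeff_zero f k).1 hf n (not_lt.1 hn)
  · intro h e he hdet
    obtain ⟨v, hv0, hv⟩ := exists_vecMul_eq_zero_iff.2 hdet
    have hcol : ∀ x ∈ Finset.univ.image e,
        ∑ s : Fin k, (ofFn k v).coeff s * G s x = 0 := by
      intro x hx
      obtain ⟨j, -, rfl⟩ := Finset.mem_image.1 hx
      simpa [vecMul, dotProduct] using congrFun hv j
    refine hv0 (injective_ofFn k ?_)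
    rw [map_zero]
    refine h {i | Fin.castAdd r i ∈ Finset.univ.image e} {u | Fin.natAdd m u ∈ Finset.univ.image e}
      ?_ _ (ofFn_degree_lt v) (fun i hi => hcol _ (Finset.mem_filter.1 hi).2)
      (fun u hu => hcol _ (Finset.mem_filter.1 hu).2)
    have hk : #(Finset.univ.image e) = k := by
      rw [Finset.card_image_of_injective _ he, Finset.card_fin]
    rw [Finset.card_filter, Finset.card_filter,
      ← Fin.sum_univ_add (fun x => if x ∈ Finset.univ.image e then 1 else 0),
      ← Finset.card_filter, Finset.filter_univ_mem]
    exact hk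

open Polynomial in
/-- A polynomial of degree at most `#T` vanishing on `T` is a multiple of the nodal polynomial. -/
lemma eq_C_mul_nodal {F ι : Type*} [Field F] {T : Finset ι} {a : ι → F} (ha : Set.InjOn a T)
    {f : F[X]} (hf : f.degree < (#T + 1 : ℕ)) (hT : ∀ i ∈ T, f.eval (a i) = 0) :
    f = C (f.coeff #T) * Lagrange.nodal T a := by
  rw [← sub_eq_zero]
  refine eq_zero_of_degree_lt_of_eval_index_eq_zero _ ha ?_ fun i hi => ?_
  · rw [degree_lt_iff_coeff_zero] at hf ⊢
    intro n hn
    rcases hn.eq_or_lt with rfl | hn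
    · have h1 : (Lagrange.nodal T a).coeff #T = 1 := by
        simpa using (Lagrange.nodal_monic (s := T) (v := a)).coeff_natDegree
      simp [h1]
    · have h1 : (Lagrange.nodal T a).coeff n = 0 :=
        coeff_eq_zero_of_natDegree_lt (by simpa using hn)
      simp [h1, hf n hn]
  · simp [hT i hi, Lagrange.eval_nodal_at_node hi]

open Polynomial in
/-- A polynomial of degree at most `#T + 1` vanishing on `T` and at two further points is zero. -/
lemma eq_zero_of_eval_eq_zero_of_two {F ι : Type*} [Field F] {T : Finset ι} {a : ι → F}
    (ha : Function.Injective a) {b c : F} (hab : ∀ i, a i ≠ b) (hac : ∀ i, a i ≠ c) (hbc : b ≠ c)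
    {f : F[X]} (hf : f.degree < (#T + 2 : ℕ)) (hT : ∀ i ∈ T, f.eval (a i) = 0)
    (hb : f.eval b = 0) (hc : f.eval c = 0) : f = 0 := by
  classical
  have hcard : #(insert b (insert c (T.map ⟨a, ha⟩))) = #T + 2 := by
    rw [Finset.card_insert_of_notMem, Finset.card_insert_of_notMem, Finset.card_map]
    · simp [hac]
    · simp [hab, hbc]
  refine eq_zero_of_degree_lt_of_eval_finset_eq_zero _ (hcard ▸ hf) ?_
  simpa [hb, hc] using hT

open Polynomial in
/-- A polynomial of degree at most `#T` vanishing on `T` and satisfying `f(b) = l f(c)` is zero,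
unless the nodal polynomial of `T` satisfies that relation. -/
lemma eq_zero_of_eval_sub_eq_zero {F ι : Type*} [Field F] {T : Finset ι} {a : ι → F}
    (ha : Function.Injective a) {b c l : F} {f : F[X]} (hf : f.degree < (#T + 1 : ℕ))
    (hT : ∀ i ∈ T, f.eval (a i) = 0) (hl : f.eval b - l * f.eval c = 0)
    (hne : (∏ i ∈ T, (b - a i)) - l * ∏ i ∈ T, (c - a i) ≠ 0) : f = 0 := by
  have hC := eq_C_mul_nodal ha.injOn hf hT
  rw [hC, eval_C_mul, eval_C_mul, Lagrange.eval_nodal, Lagrange.eval_nodal, mul_left_comm,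
    ← mul_sub, mul_eq_zero, or_iff_left hne] at hl
  rw [hC, hl, C_0, zero_mul]

open Polynomial in
/-- Independence of the columns of `G_2(b,c,∞)` in terms of polynomials. -/
lemma colsIndep_G2matInf_iff {F : Type*} [Field F] {k m : ℕ} (hk : 0 < k)
    (a : Fin m → F) (b c l1 l2 : F) :
    colsIndep (G2matInf k m a b c l1 l2) ↔
      ∀ (T : Finset (Fin m)) (U : Finset (Fin 3)), #T + #U = k →
        ∀ f : F[X], f.degree < k → (∀ i ∈ T, f.eval (a i) = 0) →
          (0 ∈ U → f.eval b - l1 * f.eval c = 0) → (1 ∈ U → f.eval b - l2 * f.eval c = 0) →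
          (2 ∈ U → f.coeff (k - 1) = 0) → f = 0 := by
  rw [colsIndep_iff_forall_polynomial (r := 3)]
  refine forall₃_congr fun T U _ => forall₂_congr fun f hf => ?_
  have hlast : ∑ s : Fin k, f.coeff s * (if (s : ℕ) = k - 1 then 1 else 0) = f.coeff (k - 1) := by
    rw [Finset.sum_eq_single ⟨k - 1, by omega⟩] <;> simp +contextual [Fin.ext_iff]
  have htwist (l : F) : ∑ s : Fin k, f.coeff s * (b ^ (s : ℕ) - l * c ^ (s : ℕ)) =
      f.eval b - l * f.eval c := by
    simp only [← sum_coeff_mul_pow hf, Finset.mul_sum, ← Finset.sum_sub_distrib]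
    exact Finset.sum_congr rfl fun s _ => by ring
  simp [Fin.forall_fin_succ, G2matInf, sum_coeff_mul_pow hf, htwist, ← hlast]

/-- A condition on products over strictly increasing index tuples is one over finite sets. -/
lemma forall_strictMono_prod_iff {F : Type*} [Field F] {m s : ℕ} (a : Fin m → F) (b c l : F) :
    (∀ e : Fin s → Fin m, StrictMono e →
      (∏ j, (b - a (e j))) - l * ∏ j, (c - a (e j)) ≠ 0) ↔
    ∀ T : Finset (Fin m), #T = s →
      (∏ i ∈ T, (b - a i)) - l * ∏ i ∈ T, (c - a i) ≠ 0 := by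
  constructor
  · intro h T hT
    have := h (T.orderEmbOfFin hT) (T.orderEmbOfFin hT).strictMono
    rwa [← T.map_orderEmbOfFin_univ hT, Finset.prod_map, Finset.prod_map]
  · intro h e he
    simpa using h (Finset.univ.map ⟨e, he.injective⟩) (by simp)

/-- For `3 ≤ k ≤ n-1` (here `n = m+1`), the code `C_2(b,c,∞)` is MDS,
i.e. every `k` columns of `G_2(b,c,∞)` are linearly independent, iff for every
`s ∈ {k-2, k-1}` and all `1 ≤ i_1 < ⋯ < i_s ≤ n-1` both
`∏ (b - a_{i_j}) - λ_1 ∏ (c - a_{i_j}) ≠ 0` and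
`∏ (b - a_{i_j}) - λ_2 ∏ (c - a_{i_j}) ≠ 0`. -/
theorem C2inf_MDS_iff {F : Type*} [Field F] [Fintype F] (m k : ℕ)
    (hk1 : 3 ≤ k) (hkm : k ≤ m)
    (a : Fin m → F) (b c l1 l2 : F) (hl : l1 ≠ l2)
    (hainj : Function.Injective a) (hab : ∀ i, a i ≠ b) (hac : ∀ i, a i ≠ c)
    (hbc : b ≠ c) :
    colsIndep (G2matInf k m a b c l1 l2) ↔
      ∀ s ∈ ({k - 2, k - 1} : Set ℕ), ∀ e : Fin s → Fin m, StrictMono e →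
        ((∏ j, (b - a (e j))) - l1 * ∏ j, (c - a (e j)) ≠ 0 ∧
         (∏ j, (b - a (e j))) - l2 * ∏ j, (c - a (e j)) ≠ 0) := by
  rw [colsIndep_G2matInf_iff (by omega)]
  simp only [forall_and, forall_strictMono_prod_iff]
  constructor
  · intro h
    have key (l : F) (u : Fin 3) (hu : u = 0 ∧ l = l1 ∨ u = 1 ∧ l = l2) :
        ∀ s ∈ ({k - 2, k - 1} : Set ℕ), ∀ T : Finset (Fin m), #T = s →
          (∏ i ∈ T, (b - a i)) - l * ∏ i ∈ T, (c - a i) ≠ 0 := by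
      intro s hs T hT hzero
      refine Lagrange.nodal_ne_zero (s := T) (v := a) ?_
      have hlt : (Lagrange.nodal T a).degree < k := by
        rw [Lagrange.degree_nodal, Nat.cast_lt]
        rcases hs with rfl | rfl <;> omega
      rw [← Lagrange.eval_nodal, ← Lagrange.eval_nodal] at hzero
      have hu2 : u ≠ 2 := by rintro rfl; simp at hu
      have h0 : u = 0 → l = l1 := by rintro rfl; simpa using hu
      have h1 : u = 1 → l = l2 := by rintro rfl; simpa using hu
      rcases hs with rfl | rfl
      · refine h T {u, 2} ?_ _ hlt (fun i hi => Lagrange.eval_nodal_at_node hi) ?_ ?_ fun _ => ?_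
        · rw [Finset.card_pair hu2]; omega
        · intro hm
          rw [← h0 (by simpa [eq_comm] using hm)]; exact hzero
        · intro hm
          rw [← h1 (by simpa [eq_comm] using hm)]; exact hzero
        · refine Polynomial.coeff_eq_zero_of_natDegree_lt ?_
          rw [Lagrange.natDegree_nodal]; omega
      · refine h T {u} ?_ _ hlt (fun i hi => Lagrange.eval_nodal_at_node hi) ?_ ?_ fun hm => ?_
        · rw [Finset.card_singleton]; omega
        · intro hm
          rw [← h0 (by simpa [eq_comm] using hm)]; exact hzero
        · intro hm
          rw [← h1 (by simpa [eq_comm] using hm)]; exact hzero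
        · exact absurd (Finset.mem_singleton.1 hm).symm hu2
    exact ⟨key l1 0 (by simp), key l2 1 (by simp)⟩
  · intro h T U hcard f hf hT h0 h1 h2
    have hU : #U = (if 0 ∈ U then 1 else 0) + (if 1 ∈ U then 1 else 0) +
        (if 2 ∈ U then 1 else 0) := by
      clear hcard h0 h1 h2
      revert U; decide
    obtain ⟨d, hd, hfd, hTd⟩ : ∃ d ∈ ({k - 1, k} : Set ℕ), f.degree < d ∧
        #T + ((if 0 ∈ U then 1 else 0) + (if 1 ∈ U then 1 else 0)) = d := by
      by_cases hm : 2 ∈ U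
      · refine ⟨k - 1, by simp, ?_, by simp only [hm, if_true] at hU; omega⟩
        rw [Polynomial.degree_lt_iff_coeff_zero] at hf ⊢
        intro n hn
        rcases hn.eq_or_lt with rfl | hn
        · exact h2 hm
        · exact hf n (by omega)
      · exact ⟨k, by simp, hf, by simp only [hm, if_false] at hU; omega⟩
    have hmem (hTd : #T + 1 = d) : #T ∈ ({k - 2, k - 1} : Set ℕ) := by
      rcases hd with rfl | rfl
      · left; omega
      · right; show #T = _; omega
    by_cases hm0 : 0 ∈ U <;> by_cases hm1 : 1 ∈ U <;>
      simp only [hm0, hm1, if_true, if_false, add_zero, zero_add] at hTd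
    · have hc : f.eval c = 0 := by
        have : (l1 - l2) * f.eval c = 0 := by linear_combination h1 hm1 - h0 hm0
        exact (mul_eq_zero.1 this).resolve_left (sub_ne_zero.2 hl)
      have hb : f.eval b = 0 := by simpa [hc] using h0 hm0
      exact eq_zero_of_eval_eq_zero_of_two hainj hab hac hbc (hTd ▸ hfd) hT hb hc
    · exact eq_zero_of_eval_sub_eq_zero hainj (hTd ▸ hfd) hT (h0 hm0) (h.1 _ (hmem hTd) T rfl)
    · exact eq_zero_of_eval_sub_eq_zero hainj (hTd ▸ hfd) hT (h1 hm1) (h.2 _ (hmem hTd) T rfl)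
    · exact Polynomial.eq_zero_of_degree_lt_of_eval_index_eq_zero _ hainj.injOn (hTd ▸ hfd) hT
end
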